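/- arXiv:1405.2674 — 7 statements merged into one kernel-verified Lean document; each statement's English description precedes it below -/
import Mathlib

section
/- Let X_1, X_2, … be identically distributed (not necessarily independent) nonnegative random variables with E[X_1 (log X_1)^+] < ∞. Then for every nonnegative integer-valued random variable T such that E[e^{cT}] < ∞ for some c > 0, the random sum S_T = X_1 + ⋯ + X_T has finite expectation. -/
open MeasureTheory ProbabilityTheory ENNReal

lemma aux_tsum (a : ℝ) (ha : 0 < a) (x : ℝ) (hx : 0 ≤ x) :
    ∑' i : ℕ, ENNReal.ofReal (if Real.exp (a * i) < x then x else 0) ≤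
      ENNReal.ofReal (1 / a + 1) * ENNReal.ofReal (x * max (Real.log x) 0) + ENNReal.ofReal 3 := by
  set L := max (Real.log x) 0 with hL
  have hL0 : 0 ≤ L := le_max_right _ _
  have hxL : x ≤ x * L + 3 := by
    by_cases h : x ≤ 3
    · nlinarith [mul_nonneg hx hL0]
    · have h1 : 1 ≤ Real.log x := by
        rw [Real.le_log_iff_exp_le (by linarith)]
        linarith [Real.exp_one_lt_d9]
      have h2 : 1 ≤ L := h1.trans (le_max_left _ _)
      nlinarith
  have hN : (⌈L / a⌉₊ : ℝ) ≤ L / a + 1 := (Nat.ceil_lt_add_one (by positivity)).le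
  rw [tsum_eq_sum (s := Finset.range ⌈L / a⌉₊)]
  · rw [← ENNReal.ofReal_mul (by positivity), ← ENNReal.ofReal_add (by positivity) (by norm_num),
      ← ENNReal.ofReal_sum_of_nonneg (by intro i _; split_ifs <;> simp [hx])]
    apply ENNReal.ofReal_le_ofReal
    calc _ ≤ ∑ i ∈ Finset.range ⌈L / a⌉₊, x := by
          apply Finset.sum_le_sum
          intro i _
          split_ifs <;> simp [hx]
      _ = ⌈L / a⌉₊ * x := by simp
      _ ≤ (L / a + 1) * x := by gcongr
      _ ≤ (L / a) * x + (x * L + 3) := by linarith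
      _ = _ := by ring
  · intro i hi
    have : ¬ Real.exp (a * i) < x := by
      intro h
      apply hi
      rw [Finset.mem_range, Nat.lt_ceil, lt_div_iff₀ ha]
      have h0 : 0 < x := (Real.exp_pos _).trans h
      have := (Real.lt_log_iff_exp_lt h0).2 h
      have := le_max_left (Real.log x) 0
      linarith
    simp [this]

lemma aux_point (a : ℝ) (ha : 0 < a) (n : ℕ) (x : ℕ → ℝ) (hx : ∀ i, 0 ≤ x i) :
    ENNReal.ofReal (∑ i ∈ Finset.range n, x i) ≤
      ENNReal.ofReal (1 / a) * ENNReal.ofReal (Real.exp (2 * a * n)) +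
      ∑' i : ℕ, ENNReal.ofReal (if Real.exp (a * i) < x i then x i else 0) := by
  have h1 : ∑ i ∈ Finset.range n, x i ≤ 1 / a * Real.exp (2 * a * n) +
      ∑ i ∈ Finset.range n, (if Real.exp (a * i) < x i then x i else 0) := by
    calc _ ≤ ∑ i ∈ Finset.range n,
          (Real.exp (a * n) + (if Real.exp (a * i) < x i then x i else 0)) := by
          apply Finset.sum_le_sum
          intro i hi
          have hi' : (i : ℝ) ≤ n := by exact_mod_cast (Finset.mem_range.1 hi).le
          have : Real.exp (a * i) ≤ Real.exp (a * n) := by gcongr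
          have := Real.exp_pos (a * n)
          split_ifs <;> linarith
      _ = n * Real.exp (a * n) +
          ∑ i ∈ Finset.range n, (if Real.exp (a * i) < x i then x i else 0) := by rw [Finset.sum_add_distrib]; simp
      _ ≤ _ := by
          refine add_le_add ?_ le_rfl
          have e : Real.exp (2 * a * n) = Real.exp (a * n) * Real.exp (a * n) := by
            rw [← Real.exp_add]; ring_nf
          have h := Real.add_one_le_exp (a * n)
          rw [e, ← mul_assoc]
          gcongr
          rw [one_div, inv_mul_eq_div, le_div_iff₀ ha]
          linarith
  refine (ENNReal.ofReal_le_ofReal h1).trans (ENNReal.ofReal_add_le.trans ?_)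
  rw [ENNReal.ofReal_mul (by positivity)]
  gcongr
  rw [ENNReal.ofReal_sum_of_nonneg (by intro i _; split_ifs <;> simp [hx])]
  exact ENNReal.sum_le_tsum _

/-- If `X_1, X_2, …` are identically distributed nonnegative random variables
(independence not assumed; here `X i` denotes `X_{i+1}`, so `S n = X_1 + ⋯ + X_n`) with
`E[X_1 (log X_1)^+] < ∞`, then for every nonnegative integer-valued random variable `T`
with `E[e^{cT}] < ∞` for some `c > 0`, the random sum `S_T` has finite expectation. -/
theorem exp_moment_forward
    {Ω : Type*} [MeasurableSpace Ω] (P : Measure Ω) [IsProbabilityMeasure P]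
    (X : ℕ → Ω → ℝ) (hmeas : ∀ i, Measurable (X i))
    (hnonneg : ∀ i ω, 0 ≤ X i ω)
    (hident : ∀ i, IdentDistrib (X i) (X 0) P P)
    (hXlog : ∫⁻ ω, ENNReal.ofReal (X 0 ω * max (Real.log (X 0 ω)) 0) ∂P < ⊤)
    (T : Ω → ℕ) (hT : Measurable T)
    (hTexp : ∃ c : ℝ, 0 < c ∧ ∫⁻ ω, ENNReal.ofReal (Real.exp (c * T ω)) ∂P < ⊤) :
    ∫⁻ ω, ENNReal.ofReal (∑ i ∈ Finset.range (T ω), X i ω) ∂P < ⊤ := by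
  obtain ⟨c, hc, hTc⟩ := hTexp
  have ha : 0 < c / 2 := by positivity
  have hg : ∀ i : ℕ, Measurable (fun x : ℝ =>
      ENNReal.ofReal (if Real.exp (c / 2 * i) < x then x else 0)) := by
    intro i
    exact (Measurable.ite measurableSet_Ioi measurable_id measurable_const).ennreal_ofReal
  have hm : Measurable (fun ω => ENNReal.ofReal (Real.exp (c * T ω))) := by fun_prop
  have hm2 : Measurable (fun ω => ENNReal.ofReal (X 0 ω * max (Real.log (X 0 ω)) 0)) := by
    have := hmeas 0
    fun_prop
  calc _ ≤ ∫⁻ ω, (ENNReal.ofReal (1 / (c / 2)) * ENNReal.ofReal (Real.exp (c * T ω)) +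
        ∑' i : ℕ, ENNReal.ofReal (if Real.exp (c / 2 * i) < X i ω then X i ω else 0)) ∂P := by
        apply lintegral_mono
        intro ω
        have := aux_point (c / 2) ha (T ω) (fun i => X i ω) (fun i => hnonneg i ω)
        rwa [show 2 * (c / 2) = c by ring] at this
    _ = ENNReal.ofReal (1 / (c / 2)) * ∫⁻ ω, ENNReal.ofReal (Real.exp (c * T ω)) ∂P +
        ∑' i : ℕ, ∫⁻ ω, ENNReal.ofReal
          (if Real.exp (c / 2 * i) < X i ω then X i ω else 0) ∂P := by
        rw [lintegral_add_left (hm.const_mul _), lintegral_const_mul _ hm,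
          lintegral_tsum]
        exact fun i => ((hg i).comp (hmeas i)).aemeasurable
    _ = ENNReal.ofReal (1 / (c / 2)) * ∫⁻ ω, ENNReal.ofReal (Real.exp (c * T ω)) ∂P +
        ∑' i : ℕ, ∫⁻ ω, ENNReal.ofReal
          (if Real.exp (c / 2 * i) < X 0 ω then X 0 ω else 0) ∂P := by
        congr 2
        funext i
        exact ((hident i).comp (hg i)).lintegral_eq
    _ = ENNReal.ofReal (1 / (c / 2)) * ∫⁻ ω, ENNReal.ofReal (Real.exp (c * T ω)) ∂P +
        ∫⁻ ω, ∑' i : ℕ, ENNReal.ofReal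
          (if Real.exp (c / 2 * i) < X 0 ω then X 0 ω else 0) ∂P := by
        rw [lintegral_tsum]
        exact fun i => ((hg i).comp (hmeas 0)).aemeasurable
    _ ≤ ENNReal.ofReal (1 / (c / 2)) * ∫⁻ ω, ENNReal.ofReal (Real.exp (c * T ω)) ∂P +
        ∫⁻ ω, (ENNReal.ofReal (1 / (c / 2) + 1) *
          ENNReal.ofReal (X 0 ω * max (Real.log (X 0 ω)) 0) + ENNReal.ofReal 3) ∂P := by
        gcongr with ω
        exact aux_tsum (c / 2) ha (X 0 ω) (hnonneg 0 ω)
    _ < ⊤ := by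
        rw [lintegral_add_left (hm2.const_mul _), lintegral_const_mul _ hm2, lintegral_const,
          measure_univ, mul_one]
        exact ENNReal.add_lt_top.2 ⟨ENNReal.mul_lt_top ENNReal.ofReal_lt_top hTc,
          ENNReal.add_lt_top.2 ⟨ENNReal.mul_lt_top ENNReal.ofReal_lt_top hXlog,
            ENNReal.ofReal_lt_top⟩⟩
end

section
/- Let X_1, X_2, … be identically distributed (not necessarily independent) nonnegative random variables. If for every nonnegative integer-valued random variable T satisfying E[e^{cT}] < ∞ for some c > 0 one has E[S_T] < ∞ (where S_T = X_1 + ⋯ + X_T), then E[X_1 (log X_1)^+] < ∞. -/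
open MeasureTheory ProbabilityTheory ENNReal

/-- the truncated function -/
noncomputable def truncAux (k : ℕ) (x : ℝ) : ℝ≥0∞ :=
  (Set.Ici (Real.exp k)).indicator (fun y => ENNReal.ofReal y) x

lemma measurable_truncAux (k : ℕ) : Measurable (truncAux k) :=
  ENNReal.measurable_ofReal.indicator measurableSet_Ici

lemma le_tsum_truncAux (x : ℝ) (hx : 0 ≤ x) :
    ENNReal.ofReal (x * max (Real.log x) 0) ≤ ∑' k, truncAux k x := by
  rcases le_or_gt x 1 with h1 | h1
  · rw [max_eq_right (Real.log_nonpos hx h1)]; simp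
  have hl : 0 ≤ Real.log x := Real.log_nonneg h1.le
  rw [max_eq_left hl]
  refine le_trans ?_ (ENNReal.sum_le_tsum (Finset.range (⌊Real.log x⌋₊ + 1)))
  have : ∀ k ∈ Finset.range (⌊Real.log x⌋₊ + 1), truncAux k x = ENNReal.ofReal x := by
    intro k hk
    have hk' : k ≤ ⌊Real.log x⌋₊ := by
      have := Finset.mem_range.1 hk
      omega
    have h2 : (k : ℝ) ≤ Real.log x := (Nat.le_floor_iff hl).1 hk'
    apply Set.indicator_of_mem
    exact (Real.le_log_iff_exp_le (by linarith)).1 h2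
  rw [Finset.sum_congr rfl this, Finset.sum_const, Finset.card_range, ← ENNReal.ofReal_nsmul]
  apply ENNReal.ofReal_le_ofReal
  rw [nsmul_eq_mul, mul_comm]
  apply mul_le_mul_of_nonneg_right _ hx
  push_cast
  exact (Nat.lt_floor_add_one _).le

/-- If `X_1, X_2, …` are identically distributed nonnegative random variables
(independence not assumed; here `X i` denotes `X_{i+1}`) such that `E[S_T] < ∞` for every
nonnegative integer-valued random variable `T` having a finite exponential moment
`E[e^{cT}] < ∞` for some `c > 0`, then `E[X_1 (log X_1)^+] < ∞`. -/
theorem exp_moment_converse_sum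
    {Ω : Type*} [MeasurableSpace Ω] (P : Measure Ω) [IsProbabilityMeasure P]
    (X : ℕ → Ω → ℝ) (hmeas : ∀ i, Measurable (X i))
    (hnonneg : ∀ i ω, 0 ≤ X i ω)
    (hident : ∀ i, IdentDistrib (X i) (X 0) P P)
    (hyp : ∀ T : Ω → ℕ, Measurable T →
      (∃ c : ℝ, 0 < c ∧ ∫⁻ ω, ENNReal.ofReal (Real.exp (c * T ω)) ∂P < ⊤) →
      ∫⁻ ω, ENNReal.ofReal (∑ i ∈ Finset.range (T ω), X i ω) ∂P < ⊤) :
    ∫⁻ ω, ENNReal.ofReal (X 0 ω * max (Real.log (X 0 ω)) 0) ∂P < ⊤ := by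
  have hM : ∫⁻ ω, ENNReal.ofReal (X 0 ω) ∂P < ⊤ := by
    have := hyp (fun _ => 1) measurable_const ⟨1, one_pos, by simp⟩
    simpa using this
  set M := ∫⁻ ω, ENNReal.ofReal (X 0 ω) ∂P with hMdef
  let A : ℕ → Set Ω := fun k => {ω | Real.exp k ≤ X k ω}
  have hA : ∀ k, MeasurableSet (A k) := fun k => measurableSet_le measurable_const (hmeas k)
  have hPA : ∀ k, P (A k) ≤ M * ENNReal.ofReal (Real.exp (-k)) := by
    intro k
    have h1 : ∫⁻ ω, ENNReal.ofReal (X k ω) ∂P = M :=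
      ((hident k).comp ENNReal.measurable_ofReal).lintegral_eq
    have h2 := mul_meas_ge_le_lintegral (μ := P) (hmeas k).ennreal_ofReal
      (ENNReal.ofReal (Real.exp k))
    rw [h1] at h2
    have h3 : A k ⊆ {ω | ENNReal.ofReal (Real.exp k) ≤ ENNReal.ofReal (X k ω)} :=
      fun ω hω => ENNReal.ofReal_le_ofReal hω
    have h4 : ENNReal.ofReal (Real.exp (-k)) * ENNReal.ofReal (Real.exp k) = 1 := by
      rw [← ENNReal.ofReal_mul (Real.exp_pos _).le, ← Real.exp_add]; simp
    calc P (A k) = ENNReal.ofReal (Real.exp (-k)) * (ENNReal.ofReal (Real.exp k) * P (A k)) := by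
          rw [← mul_assoc, h4, one_mul]
      _ ≤ ENNReal.ofReal (Real.exp (-k)) * M := by
          gcongr
          exact le_trans (by gcongr) h2
      _ = _ := mul_comm _ _
  have hsum : ∑' k : ℕ, ENNReal.ofReal (Real.exp ((k + 1 : ℝ) / 2)) * P (A k) ≠ ⊤ := by
    have hs : Summable (fun k : ℕ => Real.exp (1/2) * Real.exp (k * (-(1/2)))) :=
      (Real.summable_exp_nat_mul_iff.2 (by norm_num)).mul_left _
    have hle : ∑' k : ℕ, ENNReal.ofReal (Real.exp ((k + 1 : ℝ) / 2)) * P (A k)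
        ≤ M * ∑' k : ℕ, ENNReal.ofReal (Real.exp (1/2) * Real.exp (k * (-(1/2)))) := by
      rw [← ENNReal.tsum_mul_left]
      refine ENNReal.tsum_le_tsum fun k => ?_
      calc _ ≤ ENNReal.ofReal (Real.exp ((k + 1 : ℝ) / 2)) *
            (M * ENNReal.ofReal (Real.exp (-k))) := by gcongr; exact hPA k
        _ = M * (ENNReal.ofReal (Real.exp ((k + 1 : ℝ) / 2)) * ENNReal.ofReal (Real.exp (-k))) := by
            ring
        _ = _ := by
            rw [← ENNReal.ofReal_mul (Real.exp_pos _).le, ← Real.exp_add, ← Real.exp_add]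
            congr 3; ring
        _ ≤ _ := le_rfl
    exact ne_top_of_le_ne_top (ENNReal.mul_ne_top hM.ne hs.tsum_ofReal_ne_top) hle
  have hsumA : ∑' k : ℕ, P (A k) ≠ ⊤ := by
    refine ne_top_of_le_ne_top hsum (ENNReal.tsum_le_tsum fun k => ?_)
    have : (1 : ℝ≥0∞) ≤ ENNReal.ofReal (Real.exp ((k + 1 : ℝ) / 2)) := by
      rw [ENNReal.one_le_ofReal]; exact Real.one_le_exp (by positivity)
    calc P (A k) = 1 * P (A k) := (one_mul _).symm
      _ ≤ _ := by gcongr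
  have hBC := ae_eventually_notMem hsumA
  let B : Ω → Set ℕ := fun ω => {m | ∃ k, m = k + 1 ∧ ω ∈ A k}
  let T : Ω → ℕ := fun ω => sSup (B ω)
  have hTunb : ∀ ω, ¬ BddAbove (B ω) → T ω = 0 := fun ω h => by
    simp only [T]; rw [csSup_of_not_bddAbove h]; simp
  have hTmem : ∀ ω, T ω = 0 ∨ ∃ k, T ω = k + 1 ∧ ω ∈ A k := by
    intro ω
    by_cases hb : BddAbove (B ω)
    · rcases (B ω).eq_empty_or_nonempty with he | hne
      · left; simp [T, he]
      · right; exact Nat.sSup_mem hne hb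
    · exact Or.inl (hTunb ω hb)
  have hTle : ∀ n, T ⁻¹' Set.Iic n =
      (⋂ m, ⋃ k, ⋃ (_ : m ≤ k), A k) ∪ ⋂ k, ⋂ (_ : n ≤ k), (A k)ᶜ := by
    intro n
    ext ω
    simp only [Set.mem_preimage, Set.mem_Iic, Set.mem_union, Set.mem_iInter, Set.mem_iUnion,
      Set.mem_compl_iff, exists_prop]
    by_cases hb : BddAbove (B ω)
    · constructor
      · intro h
        right
        intro k hk hkA
        have : k + 1 ≤ T ω := le_csSup hb ⟨k, rfl, hkA⟩
        omega
      · rintro (h | h)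
        · obtain ⟨b, hb⟩ := hb
          obtain ⟨k, hk, hkA⟩ := h b
          have : k + 1 ≤ b := hb ⟨k, rfl, hkA⟩
          omega
        · rcases hTmem ω with h0 | ⟨k, hk, hkA⟩
          · omega
          · by_contra hlt
            exact h k (by omega) hkA
    · rw [hTunb ω hb]
      simp only [Nat.zero_le, true_iff]
      left
      intro m
      by_contra hcon
      push Not at hcon
      apply hb
      refine ⟨m, ?_⟩
      rintro _ ⟨k, rfl, hkA⟩
      by_contra hlt
      exact hcon k (by omega) hkA
  have hTmeas : Measurable T := by
    refine measurable_of_Iic fun n => ?_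
    rw [hTle n]
    exact (MeasurableSet.iInter fun m => .iUnion fun k => .iUnion fun _ => hA k).union
      (MeasurableSet.iInter fun k => .iInter fun _ => (hA k).compl)
  have hTexp : ∫⁻ ω, ENNReal.ofReal (Real.exp ((1/2 : ℝ) * T ω)) ∂P < ⊤ := by
    have hpt : ∀ ω, ENNReal.ofReal (Real.exp ((1/2 : ℝ) * T ω)) ≤
        1 + ∑' k : ℕ, (A k).indicator
          (fun _ => ENNReal.ofReal (Real.exp ((k + 1 : ℝ) / 2))) ω := by
      intro ω
      rcases hTmem ω with h0 | ⟨k, hk, hkA⟩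
      · rw [h0]; simp
      · refine le_trans ?_ le_add_self
        refine le_trans ?_ (ENNReal.le_tsum k)
        rw [Set.indicator_of_mem hkA, hk]
        apply le_of_eq; congr 2; push_cast; ring
    refine lt_of_le_of_lt (lintegral_mono hpt) ?_
    rw [lintegral_add_left measurable_const, lintegral_tsum
      (fun k => (measurable_const.indicator (hA k)).aemeasurable)]
    simp only [lintegral_indicator_const (hA _), lintegral_const, measure_univ, one_mul]
    exact ENNReal.add_lt_top.2 ⟨by simp, hsum.lt_top⟩
  have hfin := hyp T hTmeas ⟨1/2, by norm_num, hTexp⟩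
  calc ∫⁻ ω, ENNReal.ofReal (X 0 ω * max (Real.log (X 0 ω)) 0) ∂P
      ≤ ∫⁻ ω, ∑' k, truncAux k (X 0 ω) ∂P :=
        lintegral_mono fun ω => le_tsum_truncAux _ (hnonneg 0 ω)
    _ = ∑' k, ∫⁻ ω, truncAux k (X 0 ω) ∂P :=
        lintegral_tsum fun k => ((measurable_truncAux k).comp (hmeas 0)).aemeasurable
    _ = ∑' k, ∫⁻ ω, truncAux k (X k ω) ∂P := by
        congr 1; ext k
        exact ((hident k).comp (measurable_truncAux k)).lintegral_eq.symm
    _ = ∫⁻ ω, ∑' k, truncAux k (X k ω) ∂P :=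
        (lintegral_tsum fun k => ((measurable_truncAux k).comp (hmeas k)).aemeasurable).symm
    _ ≤ ∫⁻ ω, ENNReal.ofReal (∑ i ∈ Finset.range (T ω), X i ω) ∂P := by
        apply lintegral_mono_ae
        filter_upwards [hBC] with ω hω
        obtain ⟨N, hN⟩ := Filter.eventually_atTop.1 hω
        have hb : BddAbove (B ω) := by
          refine ⟨N, ?_⟩
          rintro _ ⟨k, rfl, hkA⟩
          by_contra hlt
          exact hN k (by omega) hkA
        rw [tsum_eq_sum (s := Finset.range (T ω)), ENNReal.ofReal_sum_of_nonneg
          (fun i _ => hnonneg i ω)]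
        · exact Finset.sum_le_sum fun k _ => Set.indicator_le_self' (fun _ _ => zero_le) _
        · intro k hk
          apply Set.indicator_of_notMem
          intro hkA
          have : k + 1 ≤ T ω := le_csSup hb ⟨k, rfl, hkA⟩
          exact hk (Finset.mem_range.2 (by omega))
    _ < ⊤ := hfin
end

section
/- Let 1 < α ≤ 2 and let X be a nonnegative random variable with E[X^α] < ∞. Then for every nonnegative integer-valued random variable T with E[T^{α/(α-1)}] < ∞ and every sequence X_1, X_2, … of random variables each having the same distribution as X (no independence assumed), defined on the same probability space as T, the random sum S_T = X_1 + ⋯ + X_T has finite expectation. -/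
open MeasureTheory ProbabilityTheory ENNReal

/-- Truncated value: `y` if `i + 1 ≤ y ^ (α - 1)`, else zero. -/
noncomputable def truncG (α : ℝ) (i : ℕ) (y : ℝ) : ℝ≥0∞ :=
  Set.indicator {y : ℝ | (i : ℝ) + 1 ≤ y ^ (α - 1)} (fun y => ENNReal.ofReal y) y

lemma measurable_truncG (α : ℝ) (i : ℕ) : Measurable (truncG α i) := by
  unfold truncG
  refine Measurable.indicator ENNReal.measurable_ofReal ?_
  exact measurableSet_le measurable_const (by fun_prop)

lemma tsum_truncG_le (α : ℝ) (hα1 : 1 < α) (x : ℝ) (hx : 0 ≤ x) :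
    ∑' i, truncG α i x ≤ ENNReal.ofReal (x ^ α) := by
  have hz : ∀ i ∉ Finset.range ⌊x ^ (α - 1)⌋₊, truncG α i x = 0 := by
    intro i hi
    unfold truncG
    apply Set.indicator_of_notMem
    intro h
    apply hi
    rw [Finset.mem_range, ← Nat.succ_le_iff]
    apply Nat.le_floor
    push_cast
    exact h
  rw [tsum_eq_sum hz]
  have hnn : 0 ≤ x ^ (α - 1) := Real.rpow_nonneg hx _
  calc ∑ i ∈ Finset.range ⌊x ^ (α - 1)⌋₊, truncG α i x
      ≤ ∑ i ∈ Finset.range ⌊x ^ (α - 1)⌋₊, ENNReal.ofReal x :=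
        Finset.sum_le_sum fun i _ => Set.indicator_le_self _ _ _
    _ = ENNReal.ofReal (⌊x ^ (α - 1)⌋₊ * x) := by
        rw [ENNReal.ofReal_mul (by positivity)]
        simp
    _ ≤ ENNReal.ofReal (x ^ α) := by
        apply ENNReal.ofReal_le_ofReal
        calc (⌊x ^ (α - 1)⌋₊ : ℝ) * x ≤ x ^ (α - 1) * x := by
              gcongr
              exact Nat.floor_le hnn
          _ = x ^ α := by
              rw [← Real.rpow_add_one' hx (by linarith)]
              congr 1
              ring

lemma ofReal_le_truncG_add (α : ℝ) (hα1 : 1 < α) (n i : ℕ) (hi : i < n) (y : ℝ) :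
    ENNReal.ofReal y ≤ truncG α i y + (n : ℝ≥0∞) ^ (1 / (α - 1)) := by
  by_cases h : (i : ℝ) + 1 ≤ y ^ (α - 1)
  · have : truncG α i y = ENNReal.ofReal y := Set.indicator_of_mem (s := {y : ℝ | (i : ℝ) + 1 ≤ y ^ (α - 1)}) h _
    rw [this]
    exact le_self_add
  · refine le_trans ?_ le_add_self
    rcases le_or_gt y 0 with hy | hy
    · rw [ENNReal.ofReal_of_nonpos hy]
      exact zero_le
    · have hpos : 0 < α - 1 := by linarith
      have h1 : ENNReal.ofReal y ^ (α - 1) ≤ (n : ℝ≥0∞) := by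
        rw [ENNReal.ofReal_rpow_of_pos hy, ← ENNReal.ofReal_natCast]
        apply ENNReal.ofReal_le_ofReal
        have : (i : ℝ) + 1 ≤ n := by exact_mod_cast hi
        linarith
      rw [one_div]
      exact (ENNReal.le_rpow_inv_iff hpos).2 h1

/-- Let `1 < α ≤ 2` and let `X` be a nonnegative random variable with
`E[X^α] < ∞`. Then for every nonnegative integer-valued random variable `T` with
`E[T^{α/(α-1)}] < ∞` and every sequence `X_1, X_2, …` (here `Y i` denotes `X_{i+1}`)
of random variables each distributed as `X` (no independence assumed) on the same space
as `T`, the random sum `S_T = X_1 + ⋯ + X_T` has finite expectation. -/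
theorem dependent_forward
    {Ω : Type*} [MeasurableSpace Ω] (P : Measure Ω) [IsProbabilityMeasure P]
    (X : Ω → ℝ) (hXmeas : Measurable X) (hXnonneg : ∀ ω, 0 ≤ X ω)
    (α : ℝ) (hα1 : 1 < α) (hα2 : α ≤ 2)
    (hXα : ∫⁻ ω, ENNReal.ofReal (X ω ^ α) ∂P < ⊤)
    (T : Ω → ℕ) (hT : Measurable T)
    (hTmom : ∫⁻ ω, (T ω : ℝ≥0∞) ^ (α / (α - 1)) ∂P < ⊤)
    (Y : ℕ → Ω → ℝ) (hYmeas : ∀ i, Measurable (Y i))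
    (hYident : ∀ i, IdentDistrib (Y i) X P P) :
    ∫⁻ ω, ENNReal.ofReal (∑ i ∈ Finset.range (T ω), Y i ω) ∂P < ⊤ := by
  have hpos : 0 < α - 1 := by linarith
  have hpt : ∀ ω, ENNReal.ofReal (∑ i ∈ Finset.range (T ω), Y i ω) ≤
      (∑' i, truncG α i (Y i ω)) + (T ω : ℝ≥0∞) ^ (α / (α - 1)) := by
    intro ω
    calc ENNReal.ofReal (∑ i ∈ Finset.range (T ω), Y i ω)
        ≤ ∑ i ∈ Finset.range (T ω), ENNReal.ofReal (Y i ω) := by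
          refine Finset.le_sum_of_subadditive ENNReal.ofReal ?_ ?_ _ _
          · simp
          · intro a b
            exact ENNReal.ofReal_add_le
      _ ≤ ∑ i ∈ Finset.range (T ω),
            (truncG α i (Y i ω) + (T ω : ℝ≥0∞) ^ (1 / (α - 1))) :=
          Finset.sum_le_sum fun i hi =>
            ofReal_le_truncG_add α hα1 _ i (Finset.mem_range.1 hi) _
      _ = (∑ i ∈ Finset.range (T ω), truncG α i (Y i ω)) +
            (T ω : ℝ≥0∞) * (T ω : ℝ≥0∞) ^ (1 / (α - 1)) := by
          rw [Finset.sum_add_distrib]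
          simp
      _ ≤ _ := by
          refine add_le_add (ENNReal.sum_le_tsum _) (le_of_eq ?_)
          have he : α / (α - 1) = 1 + 1 / (α - 1) := by
            field_simp
            ring
          rw [he, ENNReal.rpow_add_of_nonneg _ _ zero_le_one (by positivity), ENNReal.rpow_one]
  have hm : ∀ i, Measurable fun ω => truncG α i (Y i ω) :=
    fun i => (measurable_truncG α i).comp (hYmeas i)
  have hm' : ∀ i, Measurable fun ω => truncG α i (X ω) :=
    fun i => (measurable_truncG α i).comp hXmeas
  refine lt_of_le_of_lt (lintegral_mono hpt) ?_
  rw [lintegral_add_left (Measurable.tsum hm)]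
  refine ENNReal.add_lt_top.2 ⟨?_, hTmom⟩
  rw [lintegral_tsum fun i => (hm i).aemeasurable]
  have heq : ∀ i, ∫⁻ ω, truncG α i (Y i ω) ∂P = ∫⁻ ω, truncG α i (X ω) ∂P :=
    fun i => ((hYident i).comp (measurable_truncG α i)).lintegral_eq
  simp_rw [heq]
  rw [← lintegral_tsum fun i => (hm' i).aemeasurable]
  exact lt_of_le_of_lt
    (lintegral_mono fun ω => tsum_truncG_le α hα1 (X ω) (hXnonneg ω)) hXα
end

section
/- Let 1 < α ≤ 2 and let X be a nonnegative random variable. Suppose that for every nonnegative integer-valued random variable T with E[T^{α/(α-1)}] < ∞ and every sequence X_1, X_2, … of random variables identically distributed with X (not necessarily independent) on the same space as T, one has E[S_T] < ∞, where S_T = X_1 + ⋯ + X_T. Then E[X^α] < ∞. -/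
open MeasureTheory ProbabilityTheory ENNReal

lemma exists_test {Ω : Type*} [MeasurableSpace Ω] (P : Measure Ω) [IsProbabilityMeasure P]
    (Z : Ω → ℝ≥0∞) (hZ : Measurable Z) (α : ℝ) (hα1 : 1 < α)
    (hinf : ∫⁻ ω, Z ω ^ α ∂P = ⊤) (M : ℝ≥0∞) (hM : M ≠ ⊤) :
    ∃ g : Ω → ℝ≥0∞, Measurable g ∧ ∫⁻ ω, g ω ^ (α / (α - 1)) ∂P ≤ 1 ∧
      M ≤ ∫⁻ ω, Z ω * g ω ∂P := by
  have hα0 : 0 < α := by linarith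
  have hα' : 0 < α - 1 := by linarith
  have hq : 0 < α / (α - 1) := by positivity
  have hmono : Monotone fun (n : ℕ) (ω : Ω) => (min (Z ω) n) ^ α := by
    intro m n hmn ω
    apply ENNReal.rpow_le_rpow _ hα0.le
    exact min_le_min le_rfl (by exact_mod_cast hmn)
  have hsup : ⨆ n : ℕ, ∫⁻ ω, (min (Z ω) n) ^ α ∂P = ⊤ := by
    rw [← lintegral_iSup (fun n => by fun_prop) hmono, ← top_le_iff, ← hinf]
    apply lintegral_mono
    intro ω
    have h1 : Z ω ≤ (⨆ n : ℕ, (min (Z ω) n) ^ α) ^ α⁻¹ := by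
      have h2 : Z ω = ⨆ n : ℕ, min (Z ω) (n : ℝ≥0∞) := by
        have := inf_iSup_eq (Z ω) (fun n : ℕ => (n : ℝ≥0∞))
        rw [ENNReal.iSup_natCast, inf_top_eq] at this
        exact this
      conv_lhs => rw [h2]
      apply iSup_le
      intro n
      rw [ENNReal.le_rpow_inv_iff hα0]
      exact le_iSup (fun n : ℕ => (min (Z ω) n) ^ α) n
    rwa [ENNReal.le_rpow_inv_iff hα0] at h1
  have hlt : max 1 (M ^ α) < ⨆ n : ℕ, ∫⁻ ω, (min (Z ω) n) ^ α ∂P := by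
    rw [hsup]
    exact max_lt ENNReal.one_lt_top (ENNReal.rpow_lt_top_of_nonneg hα0.le hM)
  obtain ⟨n, hn⟩ := lt_iSup_iff.1 hlt
  set c := ∫⁻ ω, (min (Z ω) n) ^ α ∂P with hc
  have hc0 : c ≠ 0 := (lt_of_lt_of_le zero_lt_one ((le_max_left _ _).trans hn.le)).ne'
  have hctop : c ≠ ⊤ := by
    have : c ≤ ∫⁻ ω, (n : ℝ≥0∞) ^ α ∂P :=
      lintegral_mono fun ω => ENNReal.rpow_le_rpow (min_le_right _ _) hα0.le
    rw [lintegral_const, measure_univ, mul_one] at this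
    exact (this.trans_lt (ENNReal.rpow_lt_top_of_nonneg hα0.le (by simp))).ne
  refine ⟨fun ω => c ^ (-((α - 1) / α)) * (min (Z ω) n) ^ (α - 1), by fun_prop, ?_, ?_⟩
  · have : ∀ ω, (c ^ (-((α - 1) / α)) * (min (Z ω) n) ^ (α - 1)) ^ (α / (α - 1))
        = c⁻¹ * (min (Z ω) n) ^ α := by
      intro ω
      rw [ENNReal.mul_rpow_of_nonneg _ _ hq.le, ← ENNReal.rpow_mul, ← ENNReal.rpow_mul,
        ← ENNReal.rpow_neg_one]
      congr 2 <;> field_simp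
    simp_rw [this]
    rw [lintegral_const_mul _ (by fun_prop), ← hc, ENNReal.inv_mul_cancel hc0 hctop]
  · have h1 : M ≤ c ^ α⁻¹ := by
      rw [ENNReal.le_rpow_inv_iff hα0]
      exact (le_max_right _ _).trans hn.le
    refine h1.trans ?_
    have h2 : c ^ α⁻¹ = ∫⁻ ω, c ^ (-((α - 1) / α)) * (min (Z ω) n) ^ α ∂P := by
      rw [lintegral_const_mul _ (by fun_prop), ← hc]
      nth_rw 3 [← ENNReal.rpow_one c]
      rw [← ENNReal.rpow_add _ _ hc0 hctop]
      congr 1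
      field_simp
      ring
    rw [h2]
    apply lintegral_mono
    intro ω
    have h3 : (min (Z ω) n) ^ α = min (Z ω) n * (min (Z ω) n) ^ (α - 1) := by
      nth_rw 2 [← ENNReal.rpow_one (min (Z ω) n)]
      rw [← ENNReal.rpow_add_of_nonneg _ _ zero_le_one hα'.le]
      congr 1
      ring
    simp only [h3]
    rw [mul_left_comm]
    gcongr
    exact min_le_left _ _

lemma exists_dual {Ω : Type*} [MeasurableSpace Ω] (P : Measure Ω) [IsProbabilityMeasure P]
    (Z : Ω → ℝ≥0∞) (hZ : Measurable Z) (α : ℝ) (hα1 : 1 < α)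
    (hinf : ∫⁻ ω, Z ω ^ α ∂P = ⊤) :
    ∃ g : Ω → ℝ≥0∞, Measurable g ∧ ∫⁻ ω, g ω ^ (α / (α - 1)) ∂P < ⊤ ∧
      ∫⁻ ω, Z ω * g ω ∂P = ⊤ := by
  have hα' : 0 < α - 1 := by linarith
  have hq : 0 < α / (α - 1) := by positivity
  have hq1 : 1 ≤ α / (α - 1) := by rw [le_div_iff₀ hα']; linarith
  choose g hgm hg1 hg2 using fun k : ℕ => exists_test P Z hZ α hα1 hinf (2 ^ k * k)
    (ENNReal.mul_ne_top (by simp) (by simp))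
  set q := α / (α - 1)
  refine ⟨fun ω => ⨆ k, (2⁻¹ : ℝ≥0∞) ^ k * g k ω, by fun_prop, ?_, ?_⟩
  · have h1 : ∀ ω, (⨆ k, (2⁻¹ : ℝ≥0∞) ^ k * g k ω) ^ q ≤ ∑' k, (2⁻¹ : ℝ≥0∞) ^ k * g k ω ^ q := by
      intro ω
      rw [← ENNReal.le_rpow_inv_iff hq]
      apply iSup_le
      intro k
      rw [ENNReal.le_rpow_inv_iff hq]
      refine le_trans ?_ (ENNReal.le_tsum k)
      rw [ENNReal.mul_rpow_of_nonneg _ _ hq.le]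
      gcongr
      refine ENNReal.rpow_le_self_of_le_one (pow_le_one' ?_ k) hq1
      simp
    refine (lintegral_mono h1).trans_lt ?_
    rw [lintegral_tsum (fun k => by fun_prop)]
    refine lt_of_le_of_lt (ENNReal.tsum_le_tsum (g := fun k => (2⁻¹ : ℝ≥0∞) ^ k) fun k => ?_) ?_
    · rw [lintegral_const_mul _ (by fun_prop)]
      exact mul_le_of_le_one_right' (hg1 k)
    · rw [ENNReal.tsum_geometric, ENNReal.one_sub_inv_two, inv_inv]
      simp
  · rw [← top_le_iff, ← ENNReal.iSup_natCast]
    apply iSup_le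
    intro k
    calc (k : ℝ≥0∞) = (2⁻¹ : ℝ≥0∞) ^ k * (2 ^ k * k) := by
          rw [← mul_assoc, ← mul_pow, ENNReal.inv_mul_cancel (by simp) (by simp), one_pow, one_mul]
      _ ≤ (2⁻¹ : ℝ≥0∞) ^ k * ∫⁻ ω, Z ω * g k ω ∂P := by gcongr; exact hg2 k
      _ = ∫⁻ ω, (2⁻¹ : ℝ≥0∞) ^ k * (Z ω * g k ω) ∂P := by
          rw [lintegral_const_mul _ (by fun_prop)]
      _ ≤ _ := by
          apply lintegral_mono
          intro ω
          simp only
          rw [mul_left_comm]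
          gcongr
          exact le_iSup (fun k => (2⁻¹ : ℝ≥0∞) ^ k * g k ω) k

/-- Let `1 < α ≤ 2` and let `X` be a nonnegative random variable. If for
every nonnegative integer-valued random variable `T` with `E[T^{α/(α-1)}] < ∞` and every
sequence `X_1, X_2, …` (here `Y i` denotes `X_{i+1}`) of random variables identically
distributed with `X` (not necessarily independent) one has `E[S_T] < ∞`, then
`E[X^α] < ∞`. -/
theorem dependent_converse
    {Ω : Type*} [MeasurableSpace Ω] (P : Measure Ω) [IsProbabilityMeasure P]
    (X : Ω → ℝ) (hXmeas : Measurable X) (hXnonneg : ∀ ω, 0 ≤ X ω)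
    (α : ℝ) (hα1 : 1 < α) (hα2 : α ≤ 2)
    (hyp : ∀ T : Ω → ℕ, Measurable T →
      ∫⁻ ω, (T ω : ℝ≥0∞) ^ (α / (α - 1)) ∂P < ⊤ →
      ∀ Y : ℕ → Ω → ℝ, (∀ i, Measurable (Y i)) →
      (∀ i, IdentDistrib (Y i) X P P) →
      ∫⁻ ω, ENNReal.ofReal (∑ i ∈ Finset.range (T ω), Y i ω) ∂P < ⊤) :
    ∫⁻ ω, ENNReal.ofReal (X ω ^ α) ∂P < ⊤ := by
  have hα' : 0 < α - 1 := by linarith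
  have hα0 : 0 < α := by linarith
  have hq : 0 < α / (α - 1) := by positivity
  have hq1 : 1 ≤ α / (α - 1) := by rw [le_div_iff₀ hα']; linarith
  by_contra hcon
  have hinf : ∫⁻ ω, (ENNReal.ofReal (X ω)) ^ α ∂P = ⊤ := by
    rw [← top_le_iff, ← not_lt_top_iff.1 hcon]
    exact lintegral_mono fun ω => (ENNReal.ofReal_rpow_of_nonneg (hXnonneg ω) hα0.le).ge
  obtain ⟨g, hgm, hg1, hg2⟩ := exists_dual P _ hXmeas.ennreal_ofReal α hα1 hinf
  set q := α / (α - 1)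
  have hfin : ∀ᵐ ω ∂P, g ω < ⊤ := by
    filter_upwards [ae_lt_top (by fun_prop) hg1.ne] with ω hω
    rw [lt_top_iff_ne_top]
    intro h
    rw [h, ENNReal.top_rpow_of_pos hq] at hω
    exact lt_irrefl _ hω
  have hT := hyp (fun ω => ⌈(g ω).toReal⌉₊) (Nat.measurable_ceil.comp hgm.ennreal_toReal) ?_
    (fun _ => X) (fun _ => hXmeas) (fun _ => IdentDistrib.refl hXmeas.aemeasurable)
  · refine absurd hT (not_lt.2 ?_)
    rw [← hg2]
    apply lintegral_mono_ae
    filter_upwards [hfin] with ω hω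
    rw [Finset.sum_const, Finset.card_range, nsmul_eq_mul, mul_comm (_ : ℝ) (X ω),
      ENNReal.ofReal_mul (hXnonneg ω)]
    gcongr
    rw [← ENNReal.ofReal_toReal hω.ne]
    apply ENNReal.ofReal_le_ofReal
    simpa [ENNReal.toReal_ofReal] using Nat.le_ceil (g ω).toReal
  · have hb : ∀ ω, ((⌈(g ω).toReal⌉₊ : ℕ) : ℝ≥0∞) ^ q ≤ 2 ^ (q - 1) * (g ω ^ q + 1 ^ q) := by
      intro ω
      refine le_trans (ENNReal.rpow_le_rpow ?_ hq.le) (ENNReal.rpow_add_le_mul_rpow_add_rpow _ _ hq1)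
      rw [← ENNReal.ofReal_natCast]
      refine (ENNReal.ofReal_le_ofReal (Nat.ceil_lt_add_one ENNReal.toReal_nonneg).le).trans ?_
      rw [ENNReal.ofReal_add ENNReal.toReal_nonneg zero_le_one, ENNReal.ofReal_one]
      gcongr
      exact ENNReal.ofReal_toReal_le
    refine (lintegral_mono hb).trans_lt ?_
    rw [lintegral_const_mul _ (by fun_prop), lintegral_add_right _ (by fun_prop)]
    refine ENNReal.mul_lt_top (ENNReal.rpow_lt_top_of_nonneg (by linarith) (by simp)) ?_
    refine ENNReal.add_lt_top.2 ⟨hg1, ?_⟩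
    simp
end

section
/- (Converse to Hölder's inequality) Let p, q > 1 with 1/p + 1/q = 1, and let X be a nonnegative random variable. If E[X·g(X)] < ∞ for every nonnegative Borel measurable function g : [0,∞) → [0,∞) satisfying E[g(X)^q] < ∞, then E[X^p] < ∞. -/
open MeasureTheory ProbabilityTheory ENNReal

/-- converse to Hölder's inequality: Let `p, q > 1` with `1/p + 1/q = 1`
and let `X` be a nonnegative random variable.  If `E[X·g(X)] < ∞` for every nonnegative
Borel function `g` with `E[g(X)^q] < ∞`, then `E[X^p] < ∞`. -/
theorem converse_holder
    {Ω : Type*} [MeasurableSpace Ω] (P : Measure Ω) [IsProbabilityMeasure P]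
    (X : Ω → ℝ) (hXmeas : Measurable X) (hXnonneg : ∀ ω, 0 ≤ X ω)
    (p q : ℝ) (hp : 1 < p) (hq : 1 < q) (hpq : 1 / p + 1 / q = 1)
    (hyp : ∀ g : ℝ → ℝ, Measurable g → (∀ x, 0 ≤ g x) →
      ∫⁻ ω, ENNReal.ofReal (g (X ω) ^ q) ∂P < ⊤ →
      ∫⁻ ω, ENNReal.ofReal (X ω * g (X ω)) ∂P < ⊤) :
    ∫⁻ ω, ENNReal.ofReal (X ω ^ p) ∂P < ⊤ := by
  by_contra hcon
  have hinf : ∫⁻ ω, ENNReal.ofReal (X ω ^ p) ∂P = ⊤ := not_lt_top_iff.mp hcon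
  have hp0 : 0 < p := by linarith
  have hq0 : 0 < q := by linarith
  have hpq' : (p - 1) * q = p := by
    field_simp at hpq
    linarith
  have hf : Measurable (fun ω => ENNReal.ofReal (X ω ^ p)) := (hXmeas.pow_const p).ennreal_ofReal
  let μ := P.withDensity (fun ω => ENNReal.ofReal (X ω ^ p))
  let S : ℕ → Set Ω := fun N => X ⁻¹' Set.Iic (N : ℝ)
  have hS : ∀ N, MeasurableSet (S N) := fun N => hXmeas measurableSet_Iic
  have hμ : ∀ N, μ (S N) = ∫⁻ ω in S N, ENNReal.ofReal (X ω ^ p) ∂P := fun N =>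
    withDensity_apply _ (hS N)
  have hfin : ∀ N, μ (S N) ≠ ⊤ := by
    intro N
    rw [hμ]
    refine ne_of_lt (lt_of_le_of_lt (setLIntegral_mono (g := fun _ => ENNReal.ofReal ((N : ℝ) ^ p))
      measurable_const ?_) ?_)
    · intro ω hω
      exact ENNReal.ofReal_le_ofReal (Real.rpow_le_rpow (hXnonneg ω) hω hp0.le)
    · rw [setLIntegral_const]
      exact ENNReal.mul_lt_top ENNReal.ofReal_lt_top (measure_lt_top _ _)
  have hmono : Monotone S := by
    intro a b hab ω hω
    exact le_trans (show X ω ≤ a from hω) (by exact_mod_cast hab)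
  have hU : ⋃ N, S N = Set.univ := by
    ext ω
    simp only [Set.mem_iUnion, Set.mem_univ, iff_true]
    exact exists_nat_ge (X ω)
  have htend : Filter.Tendsto (fun N => μ (S N)) Filter.atTop (nhds ⊤) := by
    have h := tendsto_measure_iUnion_atTop (μ := μ) hmono
    rw [hU] at h
    have : μ Set.univ = ⊤ := by
      simpa [μ] using hinf
    rwa [this] at h
  have htend' : Filter.Tendsto (fun N => (μ (S N)).toReal) Filter.atTop Filter.atTop := by
    rw [Filter.tendsto_atTop]
    intro b
    have := (ENNReal.tendsto_nhds_top_iff_nnreal.mp htend) b.toNNReal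
    filter_upwards [this] with N hN
    have h2 := ENNReal.toReal_mono (hfin N) hN.le
    exact le_trans (Real.le_coe_toNNReal b) h2
  have hex : ∀ n : ℕ, ∃ N : ℕ, 1 ≤ (μ (S N)).toReal ∧
      (n : ℝ) ^ q * (μ (S N)).toReal ^ (-(q - 1)) ≤ (1 / 2) ^ n := by
    intro n
    have h1 := (tendsto_rpow_neg_atTop (y := q - 1) (by linarith)).comp htend'
    have h2 := h1.const_mul ((n : ℝ) ^ q)
    rw [mul_zero] at h2
    have h3 := h2.eventually_le_const (show (0 : ℝ) < (1 / 2) ^ n by positivity)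
    exact ((htend'.eventually_ge_atTop 1).and h3).exists
  choose N hN1 hN2 using hex
  let m : ℕ → ℝ := fun n => (μ (S (N n))).toReal
  have hm1 : ∀ n, 1 ≤ m n := hN1
  have hm0 : ∀ n, 0 < m n := fun n => lt_of_lt_of_le one_pos (hm1 n)
  have hmμ : ∀ n, μ (S (N n)) = ENNReal.ofReal (m n) := fun n =>
    (ENNReal.ofReal_toReal (hfin _)).symm
  let c : ℕ → ℝ := fun n => n / m n
  have hc0 : ∀ n, 0 ≤ c n := fun n => div_nonneg (Nat.cast_nonneg n) (hm0 n).le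
  have hcm : ∀ n, c n ^ q * m n ≤ (1 / 2) ^ n := by
    intro n
    have h : c n ^ q * m n = (n : ℝ) ^ q * m n ^ (-(q - 1)) := by
      have : -(q - 1) = 1 - q := by ring
      rw [this, Real.rpow_sub (hm0 n), Real.rpow_one,
        Real.div_rpow (Nat.cast_nonneg n) (hm0 n).le]
      ring
    rw [h]
    exact hN2 n
  have hcq0 : ∀ n, 0 ≤ c n ^ q := fun n => Real.rpow_nonneg (hc0 n) q
  have hcq : ∀ n, c n ^ q ≤ (1 / 2) ^ n := fun n =>
    le_trans (le_mul_of_one_le_right (hcq0 n) (hm1 n)) (hcm n)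
  have hgeo : ∑' n : ℕ, ENNReal.ofReal ((1 / 2) ^ n) < ⊤ :=
    lt_top_iff_ne_top.mpr summable_geometric_two.tsum_ofReal_ne_top
  let H : ℝ → ENNReal := fun x =>
    ∑' n, (Set.Iic (N n : ℝ)).indicator (fun _ => ENNReal.ofReal (c n ^ q)) x
  have hHm : Measurable H := Measurable.tsum fun n =>
    measurable_const.indicator measurableSet_Iic
  have hHfin : ∀ x, H x ≠ ⊤ := by
    intro x
    refine ne_of_lt (lt_of_le_of_lt (ENNReal.tsum_le_tsum fun n => ?_) hgeo)
    refine le_trans (Set.indicator_le_self' (fun _ _ => zero_le) x) ?_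
    exact ENNReal.ofReal_le_ofReal (hcq n)
  let h : ℝ → ℝ := fun x => (H x).toReal ^ (1 / q)
  have hhm : Measurable h := hHm.ennreal_toReal.pow_const _
  have hh0 : ∀ x, 0 ≤ h x := fun x => Real.rpow_nonneg ENNReal.toReal_nonneg _
  have hhq : ∀ x, h x ^ q = (H x).toReal := fun x => by
    simp only [h]
    rw [← Real.rpow_mul ENNReal.toReal_nonneg, one_div_mul_cancel hq0.ne', Real.rpow_one]
  have hhc : ∀ n x, x ≤ (N n : ℝ) → c n ≤ h x := by
    intro n x hx
    rw [← Real.rpow_le_rpow_iff (hc0 n) (hh0 x) hq0, hhq, ← ENNReal.ofReal_le_iff_le_toReal (hHfin x)]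
    refine le_trans ?_ (ENNReal.le_tsum n)
    rw [Set.indicator_of_mem (show x ∈ Set.Iic (N n : ℝ) from hx)]
  have key := hyp (fun x => |x| ^ (p - 1) * h x) ((measurable_norm.pow_const _).mul hhm)
    (fun x => mul_nonneg (Real.rpow_nonneg (abs_nonneg x) _) (hh0 x)) ?_
  · obtain ⟨n, hn⟩ := ENNReal.exists_nat_gt key.ne
    refine absurd hn (not_lt.mpr ?_)
    calc (n : ENNReal) = ENNReal.ofReal (c n) * μ (S (N n)) := by
          rw [hmμ, ← ENNReal.ofReal_mul (hc0 n)]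
          simp only [c]
          rw [div_mul_cancel₀ _ (hm0 n).ne', ENNReal.ofReal_natCast]
      _ = ∫⁻ ω in S (N n), ENNReal.ofReal (c n) * ENNReal.ofReal (X ω ^ p) ∂P := by
          rw [lintegral_const_mul _ hf, hμ]
      _ ≤ ∫⁻ ω in S (N n), ENNReal.ofReal (X ω * (|X ω| ^ (p - 1) * h (X ω))) ∂P := by
          refine setLIntegral_mono' (hS _) fun ω hω => ?_
          rw [← ENNReal.ofReal_mul (hc0 n)]
          refine ENNReal.ofReal_le_ofReal ?_
          have e : X ω * |X ω| ^ (p - 1) = X ω ^ p := by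
            rw [abs_of_nonneg (hXnonneg ω)]
            conv_lhs => rw [← Real.rpow_one (X ω)]
            rw [Real.rpow_one, ← Real.rpow_one_add' (hXnonneg ω) (by linarith)]
            congr 1
            ring
          rw [← mul_assoc, e, mul_comm]
          exact mul_le_mul_of_nonneg_left (hhc n _ hω) (Real.rpow_nonneg (hXnonneg ω) _)
      _ ≤ _ := setLIntegral_le_lintegral _ _
  · calc ∫⁻ ω, ENNReal.ofReal ((|X ω| ^ (p - 1) * h (X ω)) ^ q) ∂P
        = ∫⁻ ω, ∑' n, (S (N n)).indicator
            (fun ω => ENNReal.ofReal (c n ^ q) * ENNReal.ofReal (X ω ^ p)) ω ∂P := by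
          refine lintegral_congr fun ω => ?_
          rw [abs_of_nonneg (hXnonneg ω), Real.mul_rpow (Real.rpow_nonneg (hXnonneg ω) _) (hh0 _),
            ← Real.rpow_mul (hXnonneg ω), hpq', hhq, mul_comm,
            ENNReal.ofReal_mul ENNReal.toReal_nonneg, ENNReal.ofReal_toReal (hHfin _)]
          simp only [H]
          rw [← ENNReal.tsum_mul_right]
          refine tsum_congr fun n => ?_
          by_cases hx : X ω ≤ N n <;> simp [Set.indicator, S, hx]
      _ = ∑' n, ENNReal.ofReal (c n ^ q) * μ (S (N n)) := by
          rw [lintegral_tsum fun n => ((hf.const_mul _).indicator (hS _)).aemeasurable]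
          refine tsum_congr fun n => ?_
          rw [lintegral_indicator (hS _), lintegral_const_mul _ hf, hμ]
      _ ≤ ∑' n : ℕ, ENNReal.ofReal ((1 / 2) ^ n) := by
          refine ENNReal.tsum_le_tsum fun n => ?_
          rw [hmμ, ← ENNReal.ofReal_mul (hcq0 n)]
          exact ENNReal.ofReal_le_ofReal (hcm n)
      _ < ⊤ := hgeo
end

section
/- Let X_1, X_2, … be identically distributed (not necessarily independent) nonnegative random variables with E[X_1] < ∞ but E[X_1 (log X_1)^+] = ∞. Define T := max{k ≥ 1 : X_k ≥ e^k}, with T := 0 if the set is empty and T := ∞ if it is unbounded. Then T is almost surely finite, there exists c > 0 with E[e^{cT}] < ∞, and E[S_T] = ∞, where S_T = X_1 + ⋯ + X_T. -/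
open MeasureTheory ProbabilityTheory ENNReal

/-- Let `X_1, X_2, …` be identically distributed nonnegative random
variables (independence not assumed; here `X i` denotes `X_{i+1}`) with `E[X_1] < ∞` but
`E[X_1 (log X_1)^+] = ∞`.  With `T := max{k ≥ 1 : X_k ≥ e^k}` (`T := 0` for the empty
set; `sSup` realizes this convention): the set `{k ≥ 1 : X_k ≥ e^k}` is a.s. finite
(so `T` is a.s. the genuine maximum), `E[e^{cT}] < ∞` for some `c > 0`, and
`E[S_T] = ∞`. -/
theorem log_moment_counterexample
    {Ω : Type*} [MeasurableSpace Ω] (P : Measure Ω) [IsProbabilityMeasure P]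
    (X : ℕ → Ω → ℝ) (hmeas : ∀ i, Measurable (X i))
    (hnonneg : ∀ i ω, 0 ≤ X i ω)
    (hident : ∀ i, IdentDistrib (X i) (X 0) P P)
    (hint : Integrable (X 0) P)
    (hlog : ∫⁻ ω, ENNReal.ofReal (X 0 ω * max (Real.log (X 0 ω)) 0) ∂P = ⊤)
    (T : Ω → ℕ)
    (hTdef : ∀ ω, T ω = sSup {k : ℕ | 1 ≤ k ∧ Real.exp k ≤ X (k - 1) ω}) :
    (∀ᵐ ω ∂P, {k : ℕ | 1 ≤ k ∧ Real.exp k ≤ X (k - 1) ω}.Finite) ∧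
    (∃ c : ℝ, 0 < c ∧ ∫⁻ ω, ENNReal.ofReal (Real.exp (c * T ω)) ∂P < ⊤) ∧
    ∫⁻ ω, ENNReal.ofReal (∑ i ∈ Finset.range (T ω), X i ω) ∂P = ⊤ := by
  classical
  set M : ℝ≥0∞ := ∫⁻ ω, ENNReal.ofReal (X 0 ω) ∂P with hM
  have hMtop : M ≠ ⊤ := by
    have := hint.lintegral_lt_top
    exact this.ne
  set A : ℕ → Set Ω := fun k => {ω | Real.exp ((k : ℝ) + 1) ≤ X k ω} with hA
  have hAm : ∀ k, MeasurableSet (A k) := fun k => measurableSet_le measurable_const (hmeas k)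
  have hcomp : ∀ (k : ℕ) (g : ℝ → ℝ≥0∞), Measurable g →
      ∫⁻ ω, g (X k ω) ∂P = ∫⁻ ω, g (X 0 ω) ∂P := fun k g hg =>
    ((hident k).comp hg).lintegral_eq
  have hPA : ∀ k : ℕ, ENNReal.ofReal (Real.exp ((k : ℝ) + 1)) * P (A k) ≤ M := by
    intro k
    have h1 := mul_meas_ge_le_lintegral (μ := P) (f := fun ω => ENNReal.ofReal (X k ω))
      (hmeas k).ennreal_ofReal (ENNReal.ofReal (Real.exp ((k : ℝ) + 1)))
    have h2 : ∫⁻ ω, ENNReal.ofReal (X k ω) ∂P = M :=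
      hcomp k ENNReal.ofReal ENNReal.measurable_ofReal
    rw [h2] at h1
    refine le_trans ?_ h1
    gcongr
    intro ω hω
    exact ENNReal.ofReal_le_ofReal hω
  have hPA' : ∀ k : ℕ, ENNReal.ofReal (Real.exp ((1/2) * ((k : ℝ) + 1))) * P (A k)
      ≤ ENNReal.ofReal (Real.exp ((k : ℝ) * (-1/2))) * M := by
    intro k
    calc _ ≤ ENNReal.ofReal (Real.exp ((k : ℝ) * (-1/2))) *
            (ENNReal.ofReal (Real.exp ((k : ℝ) + 1)) * P (A k)) := by
          rw [← mul_assoc, ← ENNReal.ofReal_mul (Real.exp_nonneg _), ← Real.exp_add]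
          gcongr
          linarith
      _ ≤ _ := by gcongr; exact hPA k
  have hsum : ∑' k : ℕ, ENNReal.ofReal (Real.exp ((1/2) * ((k : ℝ) + 1))) * P (A k) ≠ ⊤ := by
    refine ne_top_of_le_ne_top ?_ (ENNReal.tsum_le_tsum hPA')
    rw [ENNReal.tsum_mul_right]
    refine ENNReal.mul_ne_top ?_ hMtop
    have : Summable fun n : ℕ => Real.exp ((n : ℝ) * (-1/2)) :=
      Real.summable_exp_nat_mul_iff.2 (by norm_num)
    exact this.tsum_ofReal_ne_top
  have hsum2 : ∑' k : ℕ, P (A k) ≠ ⊤ := by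
    refine ne_top_of_le_ne_top hsum (ENNReal.tsum_le_tsum fun k => ?_)
    refine le_mul_of_one_le_left (zero_le) ?_
    rw [ENNReal.one_le_ofReal]
    exact Real.one_le_exp (by positivity)
  have hmem : ∀ (ω : Ω) (k : ℕ), ω ∈ A k ↔
      (k + 1) ∈ {k : ℕ | 1 ≤ k ∧ Real.exp k ≤ X (k - 1) ω} := by
    intro ω k
    simp [hA]
  have hfin : ∀ᵐ ω ∂P, {k : ℕ | 1 ≤ k ∧ Real.exp k ≤ X (k - 1) ω}.Finite := by
    filter_upwards [ae_finite_setOfPred_mem hsum2] with ω hω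
    refine (hω.image (· + 1)).subset ?_
    rintro k hk
    obtain ⟨j, rfl⟩ : ∃ j, k = j + 1 := ⟨k - 1, by have := hk.1; omega⟩
    exact ⟨j, (hmem ω j).2 hk, rfl⟩
  refine ⟨hfin, ⟨1/2, by norm_num, ?_⟩, ?_⟩
  · have hpt : ∀ ω, ENNReal.ofReal (Real.exp (1/2 * T ω)) ≤
        1 + ∑' k : ℕ, (A k).indicator
          (fun _ => ENNReal.ofReal (Real.exp ((1/2) * ((k : ℝ) + 1)))) ω := by
      intro ω
      rcases Nat.eq_zero_or_pos (T ω) with h0 | hpos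
      · simp [h0]
      · obtain ⟨j, hj⟩ : ∃ j, T ω = j + 1 := ⟨T ω - 1, by omega⟩
        have hb : BddAbove {k : ℕ | 1 ≤ k ∧ Real.exp k ≤ X (k - 1) ω} := by
          by_contra hb
          have := hTdef ω
          rw [Nat.sSup_of_not_bddAbove hb] at this
          omega
        have hne : {k : ℕ | 1 ≤ k ∧ Real.exp k ≤ X (k - 1) ω}.Nonempty := by
          by_contra hne
          have := hTdef ω
          rw [Set.not_nonempty_iff_eq_empty.1 hne] at this
          simp at this
          omega
        have hTm := Nat.sSup_mem hne hb
        rw [← hTdef ω, hj, ← hmem] at hTm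
        refine le_trans ?_ le_add_self
        refine le_trans ?_ (ENNReal.le_tsum j)
        rw [Set.indicator_of_mem hTm, hj]
        push_cast
        exact le_rfl
    refine lt_of_le_of_lt (lintegral_mono hpt) ?_
    rw [lintegral_add_left measurable_const, lintegral_tsum]
    · simp only [lintegral_indicator_const (hAm _)]
      simpa using hsum.lt_top
    · intro k
      exact (measurable_const.indicator (hAm k)).aemeasurable
  · set g : ℕ → ℝ → ℝ≥0∞ := fun k => (Set.Ici (Real.exp ((k : ℝ) + 1))).indicator
      ENNReal.ofReal with hg
    have hgm : ∀ k, Measurable (g k) := fun k =>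
      ENNReal.measurable_ofReal.indicator measurableSet_Ici
    have h1 : ∀ x : ℝ, 0 ≤ x → ENNReal.ofReal (x * max (Real.log x) 0) ≤
        ENNReal.ofReal x + ∑' k, g k x := by
      intro x hx
      set n := ⌊Real.log x⌋₊ with hn
      have hle : max (Real.log x) 0 ≤ (n : ℝ) + 1 :=
        max_le (Nat.lt_floor_add_one _).le (by positivity)
      calc ENNReal.ofReal (x * max (Real.log x) 0)
          ≤ ENNReal.ofReal (x + n * x) := by
            apply ENNReal.ofReal_le_ofReal
            nlinarith
        _ = ENNReal.ofReal x + ∑ k ∈ Finset.range n, g k x := by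
            rw [ENNReal.ofReal_add hx (by positivity)]
            congr 1
            have : ∀ k ∈ Finset.range n, g k x = ENNReal.ofReal x := by
              intro k hk
              have hk' : k + 1 ≤ n := Finset.mem_range.1 hk
              have hl : ((k + 1 : ℕ) : ℝ) ≤ Real.log x :=
                (Nat.le_floor_iff' (by omega)).1 hk'
              push_cast at hl
              have hx0 : 0 < x := by
                rcases hx.eq_or_lt with h | h
                · rw [← h, Real.log_zero] at hl
                  have : (0 : ℝ) ≤ k := by positivity
                  linarith
                · exact h
              exact Set.indicator_of_mem ((Real.le_log_iff_exp_le hx0).1 hl) _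
            rw [Finset.sum_congr rfl this]
            simp [ENNReal.ofReal_mul]
        _ ≤ _ := by gcongr; exact ENNReal.sum_le_tsum _
    have h2 : ∑' k, ∫⁻ ω, g k (X 0 ω) ∂P = ⊤ := by
      have h3 : (⊤ : ℝ≥0∞) ≤ M + ∑' k, ∫⁻ ω, g k (X 0 ω) ∂P := by
        rw [← hlog, ← lintegral_tsum (f := fun k ω => g k (X 0 ω)) (fun k => ((hgm k).comp (hmeas 0)).aemeasurable), hM,
          ← lintegral_add_left (hmeas 0).ennreal_ofReal]
        exact lintegral_mono fun ω => h1 _ (hnonneg 0 ω)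
      rcases ENNReal.add_eq_top.1 (top_le_iff.1 h3) with h | h
      · exact absurd h hMtop
      · exact h
    rw [← top_le_iff, ← h2]
    rw [← tsum_congr (fun k => hcomp k (g k) (hgm k))]
    rw [← lintegral_tsum (f := fun k ω => g k (X k ω)) (fun k => ((hgm k).comp (hmeas k)).aemeasurable)]
    refine lintegral_mono_ae ?_
    filter_upwards [hfin] with ω hω
    rw [ENNReal.ofReal_sum_of_nonneg (fun i _ => hnonneg i ω)]
    rw [tsum_eq_sum (s := Finset.range (T ω))]
    · exact Finset.sum_le_sum fun k _ => Set.indicator_le_self _ _ _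
    · intro k hk
      refine Set.indicator_of_notMem (fun hk2 => hk ?_) _
      have := le_csSup hω.bddAbove ((hmem ω k).1 hk2)
      rw [← hTdef ω] at this
      exact Finset.mem_range.2 this
end

section
/- Let X_1, X_2, … be identically distributed nonnegative random variables with common distribution that of X, let 1 < α ≤ 2, and let g : [0,∞) → [0,∞) be Borel measurable with E[g(X)^{α/(α-1)}] < ∞. Define T_g := max{k ≥ 1 : g(X_k) ≥ k}, with T_g := 0 if the set is empty and T_g := ∞ if it is unbounded. Then E[T_g^{1/(α-1)}] < ∞ (in particular T_g is almost surely finite), and E[S_{T_g}] ≥ E[X ⌊g(X)⌋], where S_T = X_1 + ⋯ + X_T. -/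
open MeasureTheory ProbabilityTheory ENNReal


lemma swap_aux {Ω : Type*} [MeasurableSpace Ω] (P : Measure Ω)
    (X : Ω → ℝ) (hXmeas : Measurable X)
    (Y : ℕ → Ω → ℝ) (hYmeas : ∀ i, Measurable (Y i))
    (hYident : ∀ i, IdentDistrib (Y i) X P P)
    (f : ℕ → ℝ → ℝ≥0∞) (hf : ∀ i, Measurable (f i)) :
    ∫⁻ ω, ∑' i, f i (Y i ω) ∂P = ∫⁻ ω, ∑' i, f i (X ω) ∂P := by
  rw [lintegral_tsum (f := fun i ω => f i (Y i ω)) (fun i => ((hf i).comp (hYmeas i)).aemeasurable),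
    lintegral_tsum (f := fun i ω => f i (X ω)) (fun i => ((hf i).comp hXmeas).aemeasurable)]
  congr 1
  funext i
  exact ((hYident i).comp (hf i)).lintegral_eq

lemma tsum_floor_aux (c : ℕ → ℝ≥0∞) (y : ℝ) (hy : 0 ≤ y) :
    ∑' i : ℕ, (if ((i : ℝ) + 1) ≤ y then c i else 0) = ∑ i ∈ Finset.range ⌊y⌋₊, c i := by
  have key : ∀ i : ℕ, ((i : ℝ) + 1) ≤ y ↔ i < ⌊y⌋₊ := by
    intro i
    rw [← Nat.succ_le_iff, Nat.le_floor_iff hy]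
    push_cast
    rfl
  rw [tsum_eq_sum (s := Finset.range ⌊y⌋₊)]
  · refine Finset.sum_congr rfl fun i hi => ?_
    rw [if_pos ((key i).2 (Finset.mem_range.1 hi))]
  · intro i hi
    rw [if_neg]
    rw [key]
    simpa using hi

/-- Let `X_1, X_2, …` be identically distributed nonnegative random
variables (here `X i` denotes `X_{i+1}`) with common distribution that of `X`, let
`1 < α ≤ 2`, and let `g : [0,∞) → [0,∞)` be Borel with `E[g(X)^{α/(α-1)}] < ∞`.  With
`T_g := max{k ≥ 1 : g(X_k) ≥ k}` (`T_g := 0` for the empty set; `sSup` realizes this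
convention): the set `{k ≥ 1 : g(X_k) ≥ k}` is a.s. finite, `E[T_g^{1/(α-1)}] < ∞`,
and `E[S_{T_g}] ≥ E[X ⌊g(X)⌋]`. -/
theorem last_time_Tg
    {Ω : Type*} [MeasurableSpace Ω] (P : Measure Ω) [IsProbabilityMeasure P]
    (X : Ω → ℝ) (hXmeas : Measurable X) (hXnonneg : ∀ ω, 0 ≤ X ω)
    (Y : ℕ → Ω → ℝ) (hYmeas : ∀ i, Measurable (Y i))
    (hYident : ∀ i, IdentDistrib (Y i) X P P)
    (α : ℝ) (hα1 : 1 < α) (hα2 : α ≤ 2)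
    (g : ℝ → ℝ) (hgmeas : Measurable g) (hgnonneg : ∀ x, 0 ≤ g x)
    (hg : ∫⁻ ω, ENNReal.ofReal (g (X ω) ^ (α / (α - 1))) ∂P < ⊤)
    (T : Ω → ℕ)
    (hTdef : ∀ ω, T ω = sSup {k : ℕ | 1 ≤ k ∧ (k : ℝ) ≤ g (Y (k - 1) ω)}) :
    (∀ᵐ ω ∂P, {k : ℕ | 1 ≤ k ∧ (k : ℝ) ≤ g (Y (k - 1) ω)}.Finite) ∧
    (∫⁻ ω, (T ω : ℝ≥0∞) ^ (1 / (α - 1)) ∂P < ⊤) ∧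
    ∫⁻ ω, ENNReal.ofReal (X ω * ⌊g (X ω)⌋₊) ∂P
      ≤ ∫⁻ ω, ENNReal.ofReal (∑ i ∈ Finset.range (T ω), Y i ω) ∂P := by
  classical
  have hα0 : 0 < α - 1 := by linarith
  set r : ℝ := 1 / (α - 1) with hr
  have hr0 : 0 < r := by positivity
  have hp : α / (α - 1) = r + 1 := by rw [hr]; field_simp; ring
  have hms : ∀ i : ℕ, MeasurableSet {x : ℝ | ((i : ℝ) + 1) ≤ g x} := fun i =>
    measurableSet_le measurable_const hgmeas
  let f : ℕ → ℝ → ℝ≥0∞ := fun i x => if ((i : ℝ) + 1) ≤ g x then ((i : ℝ≥0∞) + 1) ^ r else 0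
  have hf : ∀ i, Measurable (f i) := fun i =>
    Measurable.ite (hms i) measurable_const measurable_const
  have hfin : ∫⁻ ω, ∑' i, f i (Y i ω) ∂P < ⊤ := by
    rw [swap_aux P X hXmeas Y hYmeas hYident f hf]
    refine lt_of_le_of_lt (lintegral_mono fun ω => ?_) hg
    have hgn := hgnonneg (X ω)
    simp only [f]
    rw [tsum_floor_aux (fun i => ((i : ℝ≥0∞) + 1) ^ r) _ hgn, hp]
    calc ∑ i ∈ Finset.range ⌊g (X ω)⌋₊, ((i : ℝ≥0∞) + 1) ^ r
        ≤ ∑ i ∈ Finset.range ⌊g (X ω)⌋₊, ENNReal.ofReal (g (X ω)) ^ r := by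
          refine Finset.sum_le_sum fun i hi => ENNReal.rpow_le_rpow ?_ hr0.le
          have h1 : i + 1 ≤ ⌊g (X ω)⌋₊ := Finset.mem_range.1 hi
          rw [Nat.le_floor_iff hgn] at h1
          have := ENNReal.ofReal_le_ofReal h1
          rw [ENNReal.ofReal_natCast] at this
          exact_mod_cast this
      _ = (⌊g (X ω)⌋₊ : ℝ≥0∞) * ENNReal.ofReal (g (X ω)) ^ r := by simp
      _ ≤ ENNReal.ofReal (g (X ω)) * ENNReal.ofReal (g (X ω)) ^ r := by
          gcongr
          have := ENNReal.ofReal_le_ofReal (Nat.floor_le hgn)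
          rwa [ENNReal.ofReal_natCast] at this
      _ = ENNReal.ofReal (g (X ω) ^ (r + 1)) := by
          rw [← ENNReal.ofReal_rpow_of_nonneg hgn (by positivity),
            ENNReal.rpow_add_of_nonneg _ _ hr0.le zero_le_one, ENNReal.rpow_one, mul_comm]
  have hfinite : ∀ᵐ ω ∂P, {k : ℕ | 1 ≤ k ∧ (k : ℝ) ≤ g (Y (k - 1) ω)}.Finite := by
    have hm : Measurable (fun ω => ∑' i, f i (Y i ω)) :=
      Measurable.ennreal_tsum fun i => (hf i).comp (hYmeas i)
    filter_upwards [ae_lt_top hm hfin.ne] with ω hω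
    have h1 := ENNReal.finite_const_le_of_tsum_ne_top hω.ne one_ne_zero
    refine (h1.image (fun i => i + 1)).subset ?_
    rintro k ⟨hk1, hk2⟩
    refine ⟨k - 1, ?_, by simp; omega⟩
    obtain ⟨i, rfl⟩ : ∃ i, k = i + 1 := ⟨k - 1, by omega⟩
    simp only [Nat.add_sub_cancel] at hk2 ⊢
    push_cast at hk2
    simp only [Set.mem_setOf_eq, f, if_pos hk2]
    exact ENNReal.one_le_rpow (by simp) hr0
  refine ⟨hfinite, ?_, ?_⟩
  · refine lt_of_le_of_lt (lintegral_mono fun ω => ?_) hfin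
    by_cases h0 : T ω = 0
    · simp [h0, hr0]
    have hb : BddAbove {k : ℕ | 1 ≤ k ∧ (k : ℝ) ≤ g (Y (k - 1) ω)} := by
      by_contra hb
      exact h0 (by rw [hTdef, Nat.sSup_of_not_bddAbove hb])
    have hne : {k : ℕ | 1 ≤ k ∧ (k : ℝ) ≤ g (Y (k - 1) ω)}.Nonempty := by
      by_contra hne
      rw [Set.not_nonempty_iff_eq_empty] at hne
      exact h0 (by rw [hTdef, hne]; simp)
    have hmem := Nat.sSup_mem hne hb
    rw [← hTdef] at hmem
    obtain ⟨_, h2⟩ := hmem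
    obtain ⟨i, hi⟩ : ∃ i, T ω = i + 1 := ⟨T ω - 1, by omega⟩
    rw [hi] at h2 ⊢
    simp only [Nat.add_sub_cancel] at h2
    push_cast at h2 ⊢
    refine le_trans ?_ (ENNReal.le_tsum i)
    simp only [f, if_pos h2, le_refl]
  · let q : ℕ → ℝ → ℝ≥0∞ := fun i x => if ((i : ℝ) + 1) ≤ g x then ENNReal.ofReal x else 0
    have hq : ∀ i, Measurable (q i) := fun i =>
      Measurable.ite (hms i) ENNReal.measurable_ofReal measurable_const
    have hYn : ∀ᵐ ω ∂P, ∀ i, 0 ≤ Y i ω := by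
      rw [ae_all_iff]
      intro i
      exact (hYident i).symm.ae_snd (p := fun x => 0 ≤ x) measurableSet_Ici
        (Filter.Eventually.of_forall hXnonneg)
    calc ∫⁻ ω, ENNReal.ofReal (X ω * ⌊g (X ω)⌋₊) ∂P
        = ∫⁻ ω, ∑' i, q i (X ω) ∂P := by
          refine lintegral_congr fun ω => ?_
          simp only [q]
          rw [tsum_floor_aux (fun _ => ENNReal.ofReal (X ω)) _ (hgnonneg _),
            ENNReal.ofReal_mul (hXnonneg ω)]
          simp [mul_comm]
      _ = ∫⁻ ω, ∑' i, q i (Y i ω) ∂P := (swap_aux P X hXmeas Y hYmeas hYident q hq).symm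
      _ ≤ _ := by
          refine lintegral_mono_ae ?_
          filter_upwards [hfinite, hYn] with ω hω hY
          rw [ENNReal.ofReal_sum_of_nonneg fun i _ => hY i,
            tsum_eq_sum (s := Finset.range (T ω))]
          · refine Finset.sum_le_sum fun i _ => ?_
            simp only [q]
            split_ifs <;> simp
          · intro i hi
            simp only [q]
            rw [if_neg]
            intro h
            apply hi
            rw [Finset.mem_range, ← Nat.succ_le_iff, hTdef]
            exact le_csSup hω.bddAbove ⟨by omega, by simpa using h⟩
end
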